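/- arXiv:math-ph/0308011 — 7 statements merged into one kernel-verified Lean document; each statement's English description precedes it below -/
import Mathlib

section
/- For every nonnegative integer m, let k = 1/(m+2)² − 1. Then there exists a nonzero polynomial P ∈ ℂ[z] of degree m such that the function y(z) = P(z)/(z−1)^{m+2} satisfies, for all z ∈ ℂ with z ≠ 0 and z ≠ 1, the equation y''(z) + (2/z + 1/(z−1)) y'(z) + (−1/((1+k)(z−1)²) + 1/((1+k)z(z−1))) y(z) = 0. -/
open Polynomial in
/-- The polynomial `∑ j ≤ m, C(m, j) C(m + 3, j + 1) X ^ j`. -/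
noncomputable def numeratorPoly (m : ℕ) : ℂ[X] :=
  ∑ j ∈ Finset.range (m + 1), C ((m.choose j : ℂ) * ((m + 3).choose (j + 1) : ℂ)) * X ^ j

theorem numeratorPoly_coeff (m j : ℕ) :
    (numeratorPoly m).coeff j = (m.choose j : ℂ) * ((m + 3).choose (j + 1) : ℂ) := by
  simp only [numeratorPoly, Polynomial.finsetSum_coeff, Polynomial.coeff_C_mul_X_pow]
  rw [Finset.sum_ite_eq]
  split_ifs with h
  · rfl
  · rw [Nat.choose_eq_zero_of_lt (by simpa using h)]
    simp

theorem numeratorPoly_natDegree (m : ℕ) : (numeratorPoly m).natDegree = m := by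
  apply Polynomial.natDegree_eq_of_le_of_coeff_ne_zero
  · rw [Polynomial.natDegree_le_iff_coeff_eq_zero]
    intro j hj
    simp [numeratorPoly_coeff, Nat.choose_eq_zero_of_lt hj]
  · rw [numeratorPoly_coeff]
    exact_mod_cast (Nat.mul_pos (Nat.choose_pos le_rfl) (Nat.choose_pos (by omega))).ne'

theorem cast_choose_succ_mul (n j : ℕ) :
    (n.choose (j + 1) : ℂ) * (j + 1) = n.choose j * (n - j) := by
  rcases le_or_gt j n with h | h
  · have := Nat.choose_succ_right_eq n j
    rw [← Nat.cast_sub h]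
    exact_mod_cast this
  · simp [Nat.choose_eq_zero_of_lt h, Nat.choose_eq_zero_of_lt (Nat.lt_succ_of_lt h)]

theorem numeratorPoly_coeff_succ (m j : ℕ) :
    ((j : ℂ) + 1) * (j + 2) * (numeratorPoly m).coeff (j + 1) =
      (m - j) * (m + 2 - j) * (numeratorPoly m).coeff j := by
  simp only [numeratorPoly_coeff]
  have h₁ := cast_choose_succ_mul m j
  have h₂ := cast_choose_succ_mul (m + 3) (j + 1)
  push_cast at h₂
  linear_combination ((m + 3).choose (j + 1 + 1) * (j + 2) : ℂ) * h₁ +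
    (m.choose j * (m - j) : ℂ) * h₂

open Polynomial in
theorem numeratorPoly_ode (m : ℕ) :
    X * (X * derivative (derivative (numeratorPoly m)))
      - X * derivative (derivative (numeratorPoly m))
      - C (2 * m + 1 : ℂ) * (X * derivative (numeratorPoly m))
      - C 2 * derivative (numeratorPoly m)
      + C ((m + 2) * m : ℂ) * numeratorPoly m = 0 := by
  ext j
  have h := numeratorPoly_coeff_succ m j
  rcases j with _ | _ | j <;>
    simp only [coeff_add, coeff_sub, coeff_C_mul, coeff_X_mul, coeff_X_mul_zero,
      coeff_derivative, coeff_zero, zero_add] at h ⊢ <;>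
    push_cast at h ⊢ <;> linear_combination -h

theorem hasDerivAt_eval_div_pow (P : Polynomial ℂ) (n : ℕ) {z : ℂ} (hz : z ≠ 1) :
    HasDerivAt (fun w : ℂ => P.eval w / (w - 1) ^ n)
      (((Polynomial.X - 1) * P.derivative - Polynomial.C (n : ℂ) * P).eval z
        / (z - 1) ^ (n + 1)) z := by
  have hz' : z - 1 ≠ 0 := sub_ne_zero.mpr hz
  refine ((P.hasDerivAt z).div (((hasDerivAt_id z).sub_const 1).pow n)
    (pow_ne_zero n hz')).congr_deriv ?_
  rcases n with _ | n
  · simp [hz']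
  · simp
    field_simp
    ring

/-- For every nonnegative integer `m`, with `k = 1/(m+2)² - 1`, there is a
nonzero polynomial `P ∈ ℂ[z]` of degree `m` such that
`y(z) = P(z)/(z-1)^{m+2}` solves the normal variational equation (R2) of the
classical spring-pendulum for all `z ≠ 0, 1`. -/
theorem exponential_solution_exists (m : ℕ) (k : ℂ)
    (hk : k = 1 / ((m : ℂ) + 2) ^ 2 - 1) :
    ∃ P : Polynomial ℂ, P ≠ 0 ∧ P.natDegree = m ∧
      ∀ z : ℂ, z ≠ 0 → z ≠ 1 →
        deriv (deriv (fun w : ℂ => P.eval w / (w - 1) ^ (m + 2))) z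
          + (2 / z + 1 / (z - 1)) *
            deriv (fun w : ℂ => P.eval w / (w - 1) ^ (m + 2)) z
          + (-1 / ((1 + k) * (z - 1) ^ 2) + 1 / ((1 + k) * z * (z - 1))) *
            (P.eval z / (z - 1) ^ (m + 2)) = 0 := by
  refine ⟨numeratorPoly m, ?_, numeratorPoly_natDegree m, fun z hz₀ hz₁ => ?_⟩
  · intro h
    have := numeratorPoly_coeff m 0
    rw [h] at this
    simp at this
    exact absurd this (by exact_mod_cast Nat.succ_ne_zero (m + 2))
  have hz : z - 1 ≠ 0 := sub_ne_zero.mpr hz₁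
  have hm : (m : ℂ) + 2 ≠ 0 := by exact_mod_cast Nat.succ_ne_zero (m + 1)
  have hk' : 1 + k = 1 / ((m : ℂ) + 2) ^ 2 := by rw [hk]; ring
  have hd : deriv (fun w : ℂ => (numeratorPoly m).eval w / (w - 1) ^ (m + 2)) =ᶠ[nhds z] _ :=
    (isOpen_ne.eventually_mem hz₁).mono fun w hw => (hasDerivAt_eval_div_pow _ _ hw).deriv
  rw [hd.deriv_eq, hd.eq_of_nhds, (hasDerivAt_eval_div_pow _ _ hz₁).deriv, hk']
  have h := congrArg (Polynomial.eval z) (numeratorPoly_ode m)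
  simp at h ⊢
  have hu : (z - 1) ^ m ≠ 0 := pow_ne_zero m hz
  simp only [pow_succ]
  generalize (z - 1) ^ m = u at hu ⊢
  field_simp
  linear_combination (z - 1) * h
end

section
/- Let k ∈ ℂ with k ≠ 0 and k ≠ −1, let m be a nonnegative integer, and let P ∈ ℂ[z] be a polynomial with P(1) ≠ 0. If the function y(z) = P(z)/(z−1)^{m+2} satisfies, for all z ∈ ℂ with z ≠ 0 and z ≠ 1, the equation y''(z) + (2/z + 1/(z−1)) y'(z) + (−1/((1+k)(z−1)²) + 1/((1+k)z(z−1))) y(z) = 0, then k = 1/(m+2)² − 1. -/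
open Polynomial in
/-- The quotient rule for `Q(w)/(w-1)^n`, with the numerator again a polynomial. -/
theorem hasDerivAt_eval_div_sub_one_pow (Q : Polynomial ℂ) (n : ℕ) {z : ℂ} (hz : z ≠ 1) :
    HasDerivAt (fun w : ℂ => Q.eval w / (w - 1) ^ n)
      ((derivative Q * (X - 1) - C (n : ℂ) * Q).eval z / (z - 1) ^ (n + 1)) z := by
  have hz' : z - 1 ≠ 0 := sub_ne_zero.mpr hz
  have h := (Q.hasDerivAt z).div (((hasDerivAt_id z).sub_const 1).pow n) (pow_ne_zero n hz')
  refine h.congr_deriv ?_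
  cases n with
  | zero => simp [hz']
  | succ n =>
    simp only [id_eq, Pi.pow_apply, eval_sub, eval_mul, eval_X, eval_one, eval_C,
      Nat.add_sub_cancel]
    field_simp
    ring

open Polynomial in
/-- The second derivative of `Q(w)/(w-1)^n` away from `w = 1`. -/
theorem deriv_deriv_eval_div_sub_one_pow (Q : Polynomial ℂ) (n : ℕ) {z : ℂ} (hz : z ≠ 1) :
    deriv (deriv (fun w : ℂ => Q.eval w / (w - 1) ^ n)) z =
      (derivative (derivative Q * (X - 1) - C (n : ℂ) * Q) * (X - 1)
        - C ((n + 1 : ℕ) : ℂ) * (derivative Q * (X - 1) - C (n : ℂ) * Q)).eval z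
          / (z - 1) ^ (n + 2) := by
  have h : deriv (fun w : ℂ => Q.eval w / (w - 1) ^ n) =ᶠ[nhds z] fun w =>
      (derivative Q * (X - 1) - C (n : ℂ) * Q).eval w / (w - 1) ^ (n + 1) := by
    filter_upwards [isOpen_ne.mem_nhds hz] with w hw
    exact (hasDerivAt_eval_div_sub_one_pow Q n hw).deriv
  rw [h.deriv_eq]
  exact (hasDerivAt_eval_div_sub_one_pow _ (n + 1) hz).deriv

/-- Let `k ∈ ℂ`, `k ≠ 0`, `k ≠ -1`, `m` a nonnegative integer and `P ∈ ℂ[z]`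
with `P(1) ≠ 0`.  If `y(z) = P(z)/(z-1)^{m+2}` solves the normal variational
equation (R2) of the classical spring-pendulum for all `z ≠ 0, 1`, then
`k = 1/(m+2)² - 1`. -/
theorem exponential_solution_forces_k (k : ℂ) (hk0 : k ≠ 0) (hk1 : k ≠ -1)
    (m : ℕ) (P : Polynomial ℂ) (hP : P.eval 1 ≠ 0)
    (hode : ∀ z : ℂ, z ≠ 0 → z ≠ 1 →
      deriv (deriv (fun w : ℂ => P.eval w / (w - 1) ^ (m + 2))) z
        + (2 / z + 1 / (z - 1)) *
          deriv (fun w : ℂ => P.eval w / (w - 1) ^ (m + 2)) z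
        + (-1 / ((1 + k) * (z - 1) ^ 2) + 1 / ((1 + k) * z * (z - 1))) *
          (P.eval z / (z - 1) ^ (m + 2)) = 0) :
    k = 1 / ((m : ℂ) + 2) ^ 2 - 1 := by
  open Polynomial in
  have hk : 1 + k ≠ 0 := fun h => hk1 (by linear_combination h)
  set n := m + 2 with hn
  let R : Polynomial ℂ := derivative P * (X - 1) - C (n : ℂ) * P
  let S : Polynomial ℂ := derivative R * (X - 1) - C ((n + 1 : ℕ) : ℂ) * R
  let T : Polynomial ℂ := C (1 + k) * (X * S + (2 * (X - 1) + X) * R) - P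
  have hroot : ∀ z : ℂ, z ≠ 0 → z ≠ 1 → T.IsRoot z := by
    intro z hz0 hz1
    have hz1' : z - 1 ≠ 0 := sub_ne_zero.mpr hz1
    have h := hode z hz0 hz1
    rw [deriv_deriv_eval_div_sub_one_pow P n hz1,
      (hasDerivAt_eval_div_sub_one_pow P n hz1).deriv] at h
    change S.eval z / _ + _ * (R.eval z / _) + _ = 0 at h
    simp only [T, IsRoot.def, eval_sub, eval_mul, eval_add, eval_C, eval_X, eval_one,
      eval_ofNat]
    have hc : (1 + k) * (z * S.eval z + (2 * (z - 1) + z) * R.eval z) - P.eval z =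
        (1 + k) * z * (z - 1) ^ (n + 2) *
          (S.eval z / (z - 1) ^ (n + 2) + (2 / z + 1 / (z - 1)) * (R.eval z / (z - 1) ^ (n + 1))
            + (-1 / ((1 + k) * (z - 1) ^ 2) + 1 / ((1 + k) * z * (z - 1))) *
              (P.eval z / (z - 1) ^ n)) := by
      field_simp
      ring
    rw [hc, h, mul_zero]
  have hT : T = 0 := by
    refine eq_zero_of_infinite_isRoot T (Set.Infinite.mono ?_
      (Set.toFinite ({0, 1} : Set ℂ)).infinite_compl)
    intro z hz
    simp only [Set.mem_compl_iff, Set.mem_insert_iff, Set.mem_singleton_iff, not_or] at hz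
    exact hroot z hz.1 hz.2
  have h1 : T.eval 1 = 0 := by rw [hT, eval_zero]
  have hkey : (1 + k) * ((m : ℂ) + 2) ^ 2 = 1 := by
    refine mul_right_cancel₀ hP ?_
    simp [T, S, R, hn] at h1
    linear_combination h1
  have hm : ((m : ℂ) + 2) ^ 2 ≠ 0 := right_ne_zero_of_mul (hkey ▸ one_ne_zero)
  rw [eq_sub_iff_add_eq, eq_div_iff hm]
  linear_combination hkey
end

section
/- Let k be a real number with k > 0. Then there is no rational function ω ∈ ℂ(z) satisfying the Riccati equation ω' + ω² + (2/z + 1/(z−1)) ω + (−1/((1+k)(z−1)²) + 1/((1+k)z(z−1))) = 0 in the field of rational functions ℂ(z) (with ' the derivative of rational functions). Equivalently, the equation (R2) admits no nonzero solution of the form y = exp(∫ω) with ω rational. -/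
section RiccatiPolynomial

open Polynomial

/-- Over a field, if `B` splits with simple roots and `deg A < deg B = m + 1`, the sum of the
residues of `A / B` is the leading coefficient of `A / B` at infinity. -/
theorem Polynomial.coeff_div_leadingCoeff_eq_sum_roots {K : Type*} [Field K] [DecidableEq K]
    {A B : K[X]} {m : ℕ} (hB : B.Splits) (hroots : B.roots.Nodup) (hBm : B.natDegree = m + 1)
    (hAm : A.natDegree ≤ m) :
    A.coeff m / B.leadingCoeff = ∑ r ∈ B.roots.toFinset, A.eval r / B.derivative.eval r := by
  set s := B.roots.toFinset with hs
  have hcard : s.card = m + 1 := by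
    rw [hs, Multiset.toFinset_card_of_nodup hroots, ← hBm, hB.natDegree_eq_card_roots]
  have hfac : B = C B.leadingCoeff * Lagrange.nodal s id := by
    conv_lhs => rw [hB.eq_prod_roots]
    congr 1
    rw [Lagrange.nodal_eq, Finset.prod_eq_multiset_prod, hs, Multiset.toFinset_val,
      hroots.dedup]
    rfl
  have hderiv (r : K) (hr : r ∈ s) :
      B.derivative.eval r = B.leadingCoeff * ∏ j ∈ s.erase r, (r - j) := by
    conv_lhs => rw [hfac]
    rw [derivative_C_mul, eval_C_mul]
    have h := Lagrange.eval_nodal_derivative_eval_node_eq (v := (id : K → K)) hr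
    rw [Lagrange.eval_nodal] at h
    simpa using congrArg (B.leadingCoeff * ·) h
  have hdeg : A.degree < s.card := by
    rw [hcard]
    exact (degree_le_of_natDegree_le hAm).trans_lt (by exact_mod_cast m.lt_succ_self)
  have hsum := Lagrange.coeff_eq_sum (v := (id : K → K)) (s := s) Function.injective_id.injOn hdeg
  rw [hcard, Nat.add_sub_cancel] at hsum
  rw [hsum, Finset.sum_div]
  refine Finset.sum_congr rfl fun r hr => ?_
  rw [hderiv r hr, div_div, mul_comm]
  rfl

/-- The numerator of `ω' + ω² + (2/z + 1/(z-1)) ω - c/(z (z-1)²)` for `ω = A/B`, over the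
denominator `z (z-1)² B²`. -/
noncomputable def riccatiNumerator (c : ℂ) (A B : ℂ[X]) : ℂ[X] :=
  (derivative A * B - A * derivative B) * (X * (X - 1) ^ 2) + A ^ 2 * (X * (X - 1) ^ 2)
    + (3 * X - 2) * (X - 1) * (A * B) - C c * B ^ 2

theorem riccatiNumerator_mul_left (c : ℂ) (G A B : ℂ[X]) :
    riccatiNumerator c (G * A) (G * B) = G ^ 2 * riccatiNumerator c A B := by
  simp only [riccatiNumerator, derivative_mul]
  ring

theorem riccatiNumerator_eq_zero_of_eval {c : ℂ} {A B : ℂ[X]} (hB : B ≠ 0)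
    (h : ∀ z : ℂ, z ≠ 0 → z ≠ 1 → B.eval z ≠ 0 →
      deriv (fun w : ℂ => A.eval w / B.eval w) z + (A.eval z / B.eval z) ^ 2
        + (2 / z + 1 / (z - 1)) * (A.eval z / B.eval z)
        + (-c / (z - 1) ^ 2 + c / (z * (z - 1))) = 0) :
    riccatiNumerator c A B = 0 := by
  have key : riccatiNumerator c A B * (X * (X - 1) * B) = 0 := by
    refine Polynomial.funext fun z => ?_
    by_cases h0 : z = 0
    · simp [h0]
    by_cases h1 : z = 1
    · simp [h1]
    by_cases hz : B.eval z = 0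
    · simp [hz]
    have h1' : z - 1 ≠ 0 := sub_ne_zero.mpr h1
    have H := h z h0 h1 hz
    have hd : deriv (fun w : ℂ => A.eval w / B.eval w) z
        = (A.derivative.eval z * B.eval z - A.eval z * B.derivative.eval z) / B.eval z ^ 2 :=
      ((A.hasDerivAt z).div (B.hasDerivAt z) hz).deriv
    rw [hd] at H
    have : (riccatiNumerator c A B).eval z = 0 := by
      simp only [riccatiNumerator, eval_add, eval_sub, eval_mul, eval_pow, eval_X, eval_one,
        eval_C, eval_ofNat]
      field_simp at H
      linear_combination H
    simp [this]
  have h1 : (X - 1 : ℂ[X]) ≠ 0 := X_sub_C_ne_zero 1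
  exact (mul_eq_zero.mp key).resolve_right (mul_ne_zero (mul_ne_zero X_ne_zero h1) hB)

section Residues

variable {c : ℂ} {A B : ℂ[X]}

theorem eval_one_eq_zero_of_riccatiNumerator (hc : c ≠ 0) (h : riccatiNumerator c A B = 0) :
    B.eval 1 = 0 := by
  have := congrArg (eval 1) h
  simpa [riccatiNumerator, hc] using this

theorem IsCoprime.eval_ne_zero_of_eval_eq_zero (hAB : IsCoprime A B) {r : ℂ}
    (hr : B.eval r = 0) : A.eval r ≠ 0 := by
  obtain ⟨u, v, huv⟩ := hAB
  intro hA
  simpa [hA, hr] using congrArg (eval r) huv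

theorem riccati_residue_of_ne (hAB : IsCoprime A B) (h : riccatiNumerator c A B = 0) {r : ℂ}
    (hr : B.eval r = 0) (h0 : r ≠ 0) (h1 : r ≠ 1) :
    B.derivative.eval r = A.eval r := by
  have hA := hAB.eval_ne_zero_of_eval_eq_zero hr
  have h1' : r - 1 ≠ 0 := sub_ne_zero.mpr h1
  have H := congrArg (eval r) h
  simp only [riccatiNumerator, eval_add, eval_sub, eval_mul, eval_pow, eval_X, eval_one,
    eval_C, eval_ofNat, hr, eval_zero] at H
  refine mul_left_cancel₀ (mul_ne_zero hA (mul_ne_zero h0 (pow_ne_zero 2 h1'))) ?_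
  linear_combination -H

theorem riccati_residue_zero (hAB : IsCoprime A B) (h : riccatiNumerator c A B = 0)
    (hr : B.eval 0 = 0) : B.derivative.eval 0 = -A.eval 0 := by
  have hA := hAB.eval_ne_zero_of_eval_eq_zero hr
  obtain ⟨D, rfl⟩ := X_dvd_iff.mpr ((coeff_zero_eq_eval_zero B).trans hr)
  have key : (derivative A * (X * D) - A * (D + X * derivative D)) * (X - 1) ^ 2
      + A ^ 2 * (X - 1) ^ 2 + (3 * X - 2) * (X - 1) * (A * D) - C c * (X * D ^ 2) = 0 := by
    refine mul_left_cancel₀ (X_ne_zero (R := ℂ)) ?_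
    rw [mul_zero, ← h]
    simp only [riccatiNumerator, derivative_mul, derivative_X]
    ring
  have H := congrArg (eval 0) key
  simp only [eval_add, eval_sub, eval_mul, eval_pow, eval_X, eval_one,
    eval_C, eval_ofNat, eval_zero] at H
  simp only [derivative_mul, derivative_X, eval_add, eval_mul, eval_X, eval_one]
  refine mul_left_cancel₀ hA ?_
  linear_combination H

theorem riccati_residue_one (h : riccatiNumerator c A B = 0) (hr : B.eval 1 = 0) :
    A.eval 1 ^ 2 = c * B.derivative.eval 1 ^ 2 := by
  obtain ⟨D, rfl⟩ := dvd_iff_isRoot.mpr hr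
  have key : (derivative A * ((X - 1) * D) - A * (D + (X - 1) * derivative D)) * X
      + A ^ 2 * X + (3 * X - 2) * (A * D) - C c * D ^ 2 = 0 := by
    refine mul_left_cancel₀ (pow_ne_zero 2 (X_sub_C_ne_zero (1 : ℂ))) ?_
    rw [mul_zero, ← h]
    simp only [riccatiNumerator, derivative_mul, derivative_sub, derivative_X,
      map_one, derivative_one]
    ring
  have H := congrArg (eval 1) key
  simp only [eval_add, eval_sub, eval_mul, eval_pow, eval_X, eval_one,
    eval_C, eval_ofNat, eval_zero] at H
  simp only [derivative_mul, derivative_sub, derivative_X, derivative_C, eval_add, eval_sub,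
    eval_mul, eval_X, eval_one, eval_C, eval_zero]
  linear_combination H

theorem derivative_eval_ne_zero_of_riccatiNumerator (hAB : IsCoprime A B)
    (h : riccatiNumerator c A B = 0) {r : ℂ} (hr : B.eval r = 0) :
    B.derivative.eval r ≠ 0 := by
  have hA := hAB.eval_ne_zero_of_eval_eq_zero hr
  by_cases h0 : r = 0
  · subst h0
    rw [riccati_residue_zero hAB h hr]
    exact neg_ne_zero.mpr hA
  by_cases h1 : r = 1
  · subst h1
    intro hd
    have := riccati_residue_one h hr
    exact hA (by simpa [hd] using this)
  · rwa [riccati_residue_of_ne hAB h hr h0 h1]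

theorem nodup_roots_of_riccatiNumerator (hAB : IsCoprime A B) (hB : B ≠ 0)
    (h : riccatiNumerator c A B = 0) : B.roots.Nodup := by
  classical
  refine Multiset.nodup_iff_count_le_one.mpr fun r => ?_
  rw [count_roots]
  by_contra! hlt
  obtain ⟨hr, hd⟩ := (one_lt_rootMultiplicity_iff_isRoot hB).mp hlt
  exact derivative_eval_ne_zero_of_riccatiNumerator hAB h hr hd

end Residues

section Infinity

variable {c : ℂ} {A B : ℂ[X]}

/-- The top coefficient of the numerator, under the degree bounds `deg A ≤ a`, `deg B ≤ a + 1`. -/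
theorem coeff_riccatiNumerator {a : ℕ} (hA : A.natDegree ≤ a) (hB : B.natDegree ≤ a + 1) :
    (riccatiNumerator c A B).coeff (2 * a + 3)
      = A.coeff a * (2 * B.coeff (a + 1) + A.coeff a) := by
  have hXA : (X * derivative A).natDegree ≤ a := by
    rw [natDegree_le_iff_coeff_eq_zero] at hA ⊢
    rintro (_ | n) hn
    · simp
    · simp [coeff_X_mul, coeff_derivative, hA _ hn]
  have hXB : (X * derivative B).natDegree ≤ a + 1 := by
    rw [natDegree_le_iff_coeff_eq_zero] at hB ⊢
    rintro (_ | n) hn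
    · simp
    · simp [coeff_X_mul, coeff_derivative, hB _ hn]
  have cXA : (X * derivative A).coeff a = a * A.coeff a := by
    cases a with
    | zero => simp
    | succ n => simp [coeff_X_mul, coeff_derivative, mul_comm]
  have cXB : (X * derivative B).coeff (a + 1) = (a + 1) * B.coeff (a + 1) := by
    simp [coeff_X_mul, coeff_derivative, mul_comm]
  have h2 : ((X - 1 : ℂ[X]) ^ 2).natDegree ≤ 2 := by compute_degree
  have c2 : ((X - 1 : ℂ[X]) ^ 2).coeff 2 = 1 := by compute_degree!
  have h3 : (X * (X - 1 : ℂ[X]) ^ 2).natDegree ≤ 3 := by compute_degree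
  have c3 : (X * (X - 1 : ℂ[X]) ^ 2).coeff 3 = 1 := by compute_degree!
  have h4 : ((3 * X - 2) * (X - 1 : ℂ[X])).natDegree ≤ 2 := by compute_degree
  have c4 : ((3 * X - 2) * (X - 1 : ℂ[X])).coeff 2 = 3 := by compute_degree!
  have t1 : (((X * derivative A) * B) * (X - 1) ^ 2).coeff ((a + (a + 1)) + 2)
      = a * A.coeff a * B.coeff (a + 1) := by
    rw [coeff_mul_add_eq_of_natDegree_le (natDegree_mul_le_of_le hXA hB) h2,
      coeff_mul_add_eq_of_natDegree_le hXA hB, c2, cXA, mul_one]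
  have t2 : ((A * (X * derivative B)) * (X - 1) ^ 2).coeff ((a + (a + 1)) + 2)
      = A.coeff a * ((a + 1) * B.coeff (a + 1)) := by
    rw [coeff_mul_add_eq_of_natDegree_le (natDegree_mul_le_of_le hA hXB) h2,
      coeff_mul_add_eq_of_natDegree_le hA hXB, c2, cXB, mul_one]
  have t3 : ((A * A) * (X * (X - 1) ^ 2)).coeff ((a + a) + 3) = A.coeff a * A.coeff a := by
    rw [coeff_mul_add_eq_of_natDegree_le (natDegree_mul_le_of_le hA hA) h3,
      coeff_mul_add_eq_of_natDegree_le hA hA, c3, mul_one]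
  have t4 : ((A * B) * ((3 * X - 2) * (X - 1))).coeff ((a + (a + 1)) + 2)
      = A.coeff a * B.coeff (a + 1) * 3 := by
    rw [coeff_mul_add_eq_of_natDegree_le (natDegree_mul_le_of_le hA hB) h4,
      coeff_mul_add_eq_of_natDegree_le hA hB, c4]
  have t5 : (C c * (B * B)).coeff (2 * a + 3) = 0 := by
    rw [coeff_C_mul, coeff_eq_zero_of_natDegree_lt, mul_zero]
    exact (natDegree_mul_le_of_le hB hB).trans_lt (by omega)
  rw [show (a + (a + 1)) + 2 = 2 * a + 3 by ring] at t1 t2 t4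
  rw [show (a + a) + 3 = 2 * a + 3 by ring] at t3
  have hsplit : riccatiNumerator c A B = ((X * derivative A) * B) * (X - 1) ^ 2
      - (A * (X * derivative B)) * (X - 1) ^ 2 + (A * A) * (X * (X - 1) ^ 2)
      + (A * B) * ((3 * X - 2) * (X - 1)) - C c * (B * B) := by
    rw [riccatiNumerator]
    ring
  rw [hsplit, coeff_sub, coeff_add, coeff_add, coeff_sub, t1, t2, t3, t4, t5]
  ring

theorem natDegree_lt_of_riccatiNumerator (hA : A ≠ 0) (h : riccatiNumerator c A B = 0) :
    A.natDegree < B.natDegree := by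
  by_contra! hle
  have H := coeff_riccatiNumerator (c := c) le_rfl (hle.trans (Nat.le_succ _))
  rw [h, coeff_zero, coeff_eq_zero_of_natDegree_lt (Nat.lt_succ_of_le hle)] at H
  simp [hA] at H

end Infinity

/-- A rational solution forces the exponent at `z = 1`, a square root of `c`, to be an integer. -/
theorem exists_int_sq_eq_of_riccatiNumerator {c : ℂ} {A B : ℂ[X]} (hc : c ≠ 0)
    (hAB : IsCoprime A B) (hB : B ≠ 0) (h : riccatiNumerator c A B = 0) :
    ∃ n : ℤ, (n : ℂ) ^ 2 = c := by
  have hB1 := eval_one_eq_zero_of_riccatiNumerator hc h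
  have hA : A ≠ 0 := by
    rintro rfl
    exact hAB.eval_ne_zero_of_eval_eq_zero hB1 eval_zero
  have hlt := natDegree_lt_of_riccatiNumerator hA h
  obtain ⟨m, hm⟩ := Nat.exists_eq_add_of_lt (Nat.zero_lt_of_lt hlt)
  rw [zero_add] at hm
  have hAm : A.natDegree ≤ m := by omega
  have hsum := coeff_div_leadingCoeff_eq_sum_roots (IsAlgClosed.splits B)
    (nodup_roots_of_riccatiNumerator hAB hB h) hm hAm
  have hlead : B.leadingCoeff ≠ 0 := leadingCoeff_ne_zero.mpr hB
  let Z : Subring ℂ := (Int.castRingHom ℂ).range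
  have hinf : A.coeff m / B.leadingCoeff ∈ Z := by
    have H := coeff_riccatiNumerator (c := c) hAm hm.le
    rw [h, coeff_zero, ← hm, coeff_natDegree] at H
    rcases mul_eq_zero.mp H.symm with H | H
    · rw [H, zero_div]
      exact Z.zero_mem
    · refine ⟨-2, ?_⟩
      rw [eq_div_iff hlead]
      simp only [eq_intCast, Int.cast_neg, Int.cast_ofNat]
      linear_combination -H
  have h1mem : (1 : ℂ) ∈ B.roots.toFinset := by simpa [hB] using hB1
  have hrest : ∑ r ∈ B.roots.toFinset.erase 1, A.eval r / B.derivative.eval r ∈ Z := by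
    refine Z.sum_mem fun r hr => ?_
    obtain ⟨hr1, hr⟩ := Finset.mem_erase.mp hr
    have hr : B.eval r = 0 := by simpa [hB] using hr
    have hAr := hAB.eval_ne_zero_of_eval_eq_zero hr
    by_cases hr0 : r = 0
    · subst hr0
      rw [riccati_residue_zero hAB h hr, div_neg, div_self hAr]
      exact Z.neg_mem Z.one_mem
    · rw [riccati_residue_of_ne hAB h hr hr0 hr1, div_self hAr]
      exact Z.one_mem
  rw [← Finset.add_sum_erase _ _ h1mem] at hsum
  have hres : A.eval 1 / B.derivative.eval 1 ∈ Z := by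
    rw [eq_sub_of_add_eq hsum.symm]
    exact Z.sub_mem hinf hrest
  obtain ⟨n, hn⟩ := hres
  refine ⟨n, ?_⟩
  rw [eq_intCast] at hn
  rw [hn, div_pow, riccati_residue_one h hB1, mul_div_cancel_right₀]
  exact pow_ne_zero 2 (derivative_eval_ne_zero_of_riccatiNumerator hAB h hB1)

end RiccatiPolynomial


/-- For a real `k > 0`, no rational function `ω = A/B ∈ ℂ(z)` satisfies the
Riccati equation `ω' + ω² + (2/z + 1/(z-1))ω + (-1/((1+k)(z-1)²)
+ 1/((1+k)z(z-1))) = 0` associated with the normal variational equation (R2)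
of the classical spring-pendulum; equivalently (R2) has no nonzero exponential
solution `y = exp(∫ω)` with `ω` rational. -/
theorem no_riccati_rational_solution (k : ℝ) (hk : 0 < k) :
    ¬ ∃ A B : Polynomial ℂ, B ≠ 0 ∧
      ∀ z : ℂ, z ≠ 0 → z ≠ 1 → B.eval z ≠ 0 →
        deriv (fun w : ℂ => A.eval w / B.eval w) z
          + (A.eval z / B.eval z) ^ 2
          + (2 / z + 1 / (z - 1)) * (A.eval z / B.eval z)
          + (-1 / ((1 + (k : ℂ)) * (z - 1) ^ 2)
             + 1 / ((1 + (k : ℂ)) * z * (z - 1))) = 0 := by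
  rintro ⟨A, B, hB, h⟩
  have hk' : (0 : ℝ) < 1 + k := by linarith
  have hkC : (1 + (k : ℂ)) ≠ 0 := by exact_mod_cast hk'.ne'
  have hnum : riccatiNumerator (1 / (1 + (k : ℂ))) A B = 0 := by
    refine riccatiNumerator_eq_zero_of_eval hB fun z h0 h1 hz => ?_
    rw [← h z h0 h1 hz, ← neg_div, div_div, div_div, ← mul_assoc]
  obtain ⟨A', B', hA', hB', hcop⟩ := extract_gcd A B
  set G := gcd A B
  have hGB : G * B' ≠ 0 := hB' ▸ hB
  rw [hA', hB', riccatiNumerator_mul_left] at hnum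
  obtain ⟨n, hn⟩ := exists_int_sq_eq_of_riccatiNumerator (one_div_ne_zero hkC)
    ((gcd_isUnit_iff _ _).mp hcop) (right_ne_zero_of_mul hGB)
    ((mul_eq_zero.mp hnum).resolve_left (pow_ne_zero 2 (left_ne_zero_of_mul hGB)))
  have hn' : (n : ℝ) ^ 2 = 1 / (1 + k) := by exact_mod_cast hn
  have hpos : (0 : ℝ) < (n : ℝ) ^ 2 := hn' ▸ one_div_pos.mpr hk'
  have hlt : (n : ℝ) ^ 2 < 1 := by
    rw [hn', div_lt_one hk']
    linarith
  have hpos' : 0 < n ^ 2 := by exact_mod_cast hpos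
  have hlt' : n ^ 2 < 1 := by exact_mod_cast hlt
  omega
end

section
/- Let k ∈ ℂ with k ≠ 0 and k ≠ −1, and set E₁ = −(2k+1)/(2k). Let r : U → ℂ be twice differentiable on a connected open set U ⊆ ℂ, nowhere zero, satisfying r'' = 1 − k(r−1) and (r')² = 2E₁ + 2r − k(r−1)². Suppose y is twice differentiable on an open set containing z(U), where z(t) = k r(t)/(1+k), that z(t) ≠ 0 and z(t) ≠ 1 on U, and that y satisfies y''(z) + (2/z + 1/(z−1)) y'(z) + (−1/((1+k)(z−1)²) + 1/((1+k)z(z−1))) y(z) = 0 at every point z = z(t), t ∈ U. Then Θ(t) = y(k r(t)/(1+k)) satisfies the normal variational equation Θ'' + 2(r'/r) Θ' + (1/r) Θ = 0 on U. -/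
/-- Second-order chain rule for complex functions of one variable. -/
theorem deriv_deriv_comp_of_differentiableAt {y z : ℂ → ℂ} {U : Set ℂ} (hU : IsOpen U)
    (hz : ∀ t ∈ U, DifferentiableAt ℂ z t ∧ DifferentiableAt ℂ (deriv z) t)
    (hy : ∀ t ∈ U, DifferentiableAt ℂ y (z t) ∧ DifferentiableAt ℂ (deriv y) (z t))
    {t : ℂ} (ht : t ∈ U) :
    deriv (deriv (fun s => y (z s))) t
      = deriv (deriv y) (z t) * deriv z t ^ 2 + deriv y (z t) * deriv (deriv z) t := by
  have heq : deriv (fun s => y (z s)) =ᶠ[nhds t] fun s => deriv y (z s) * deriv z s := by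
    filter_upwards [hU.mem_nhds ht] with s hs
    exact ((hy s hs).1.hasDerivAt.comp s (hz s hs).1.hasDerivAt).deriv
  rw [heq.deriv_eq]
  have h := ((hy t ht).2.hasDerivAt.comp t (hz t ht).1.hasDerivAt).mul (hz t ht).2.hasDerivAt
  refine Eq.trans h.deriv ?_
  simp only [Function.comp_apply]
  ring


/-- Change of variable `t ↦ z = k r(t)/(1+k)` at the energy
`E₁ = -(2k+1)/(2k)`: a solution `y` of the Riemann P equation (R2) pulls back
along `z` to a solution `Θ(t) = y(k r(t)/(1+k))` of the normal variational
equation `Θ'' + 2(r'/r)Θ' + (1/r)Θ = 0` of the classical spring-pendulum. -/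
theorem riemannP_pullback_solves_NVE (k : ℂ) (hk0 : k ≠ 0) (hk1 : k ≠ -1)
    (E₁ : ℂ) (hE : E₁ = -(2 * k + 1) / (2 * k))
    (U : Set ℂ) (hUopen : IsOpen U) (hUconn : IsConnected U)
    (r : ℂ → ℂ)
    (hrdiff : ∀ t ∈ U, DifferentiableAt ℂ r t ∧ DifferentiableAt ℂ (deriv r) t)
    (hrne : ∀ t ∈ U, r t ≠ 0)
    (hr2 : ∀ t ∈ U, deriv (deriv r) t = 1 - k * (r t - 1))
    (hr1 : ∀ t ∈ U, (deriv r t) ^ 2 = 2 * E₁ + 2 * r t - k * (r t - 1) ^ 2)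
    (y : ℂ → ℂ) (V : Set ℂ) (hVopen : IsOpen V)
    (hVim : (fun t => k * r t / (1 + k)) '' U ⊆ V)
    (hydiff : ∀ w ∈ V, DifferentiableAt ℂ y w ∧ DifferentiableAt ℂ (deriv y) w)
    (hz0 : ∀ t ∈ U, k * r t / (1 + k) ≠ 0)
    (hz1 : ∀ t ∈ U, k * r t / (1 + k) ≠ 1)
    (hyode : ∀ t ∈ U, ∀ z : ℂ, z = k * r t / (1 + k) →
      deriv (deriv y) z + (2 / z + 1 / (z - 1)) * deriv y z
        + (-1 / ((1 + k) * (z - 1) ^ 2) + 1 / ((1 + k) * z * (z - 1))) * y z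
        = 0) :
    ∀ t ∈ U,
      deriv (deriv (fun s => y (k * r s / (1 + k)))) t
        + 2 * (deriv r t / r t) * deriv (fun s => y (k * r s / (1 + k))) t
        + (1 / r t) * y (k * r t / (1 + k)) = 0 := by
  intro t ht
  have hk1' : 1 + k ≠ 0 := fun h => hk1 (by linear_combination h)
  set z : ℂ → ℂ := fun s => k * r s / (1 + k) with hz
  have hzderiv : ∀ s ∈ U, HasDerivAt z (k * deriv r s / (1 + k)) s := fun s hs =>
    ((hrdiff s hs).1.hasDerivAt.const_mul k).div_const (1 + k)
  have hzderiv_eq : ∀ s ∈ U, deriv z =ᶠ[nhds s] fun s => k * deriv r s / (1 + k) := by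
    intro s hs
    filter_upwards [hUopen.mem_nhds hs] with u hu using (hzderiv u hu).deriv
  have hzderiv2 : ∀ s ∈ U, HasDerivAt (deriv z) (k * deriv (deriv r) s / (1 + k)) s :=
    fun s hs => (((hrdiff s hs).2.hasDerivAt.const_mul k).div_const
      (1 + k)).congr_of_eventuallyEq (hzderiv_eq s hs)
  have hyz : ∀ s ∈ U, DifferentiableAt ℂ y (z s) ∧ DifferentiableAt ℂ (deriv y) (z s) :=
    fun s hs => hydiff _ (hVim ⟨s, hs, rfl⟩)
  have hd1 : deriv (fun s => y (z s)) t = deriv y (z t) * (k * deriv r t / (1 + k)) :=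
    ((hyz t ht).1.hasDerivAt.comp t (hzderiv t ht)).deriv
  have hd2 := deriv_deriv_comp_of_differentiableAt hUopen
    (fun s hs => ⟨(hzderiv s hs).differentiableAt, (hzderiv2 s hs).differentiableAt⟩) hyz ht
  rw [(hzderiv t ht).deriv, (hzderiv2 t ht).deriv, hr2 t ht] at hd2
  have hode := hyode t ht (z t) rfl
  have hw0 : z t ≠ 0 := hz0 t ht
  have hw1 : z t - 1 ≠ 0 := sub_ne_zero.mpr (hz1 t ht)
  have hr : r t = (1 + k) * z t / k := by
    simp only [hz]
    field_simp
  have hsq : deriv r t ^ 2 = -((1 + k) ^ 2 / k) * (z t - 1) ^ 2 := by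
    rw [hr1 t ht, hE, hr]
    field_simp
    ring
  change deriv (deriv (fun s => y (z s))) t
    + 2 * (deriv r t / r t) * deriv (fun s => y (z s)) t + 1 / r t * y (z t) = 0
  rw [hd1, hd2, hr]
  generalize z t = w at *
  generalize deriv r t = p at *
  generalize deriv (deriv y) w = y₂ at *
  generalize deriv y w = y₁ at *
  generalize y w = y₀ at *
  have hmain : y₂ * (k * p / (1 + k)) ^ 2 + y₁ * (k * (1 - k * ((1 + k) * w / k - 1)) / (1 + k))
      + 2 * (p / ((1 + k) * w / k)) * (y₁ * (k * p / (1 + k))) + 1 / ((1 + k) * w / k) * y₀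
      = (y₂ + 2 / w * y₁) * (k / (1 + k)) ^ 2 * p ^ 2 + y₁ * (k * (1 - w))
        + k / ((1 + k) * w) * y₀ := by
    field_simp
    ring
  rw [hmain, hsq]
  have hfactor : (y₂ + 2 / w * y₁) * (k / (1 + k)) ^ 2 * (-((1 + k) ^ 2 / k) * (w - 1) ^ 2)
      + y₁ * (k * (1 - w)) + k / ((1 + k) * w) * y₀
      = -k * (w - 1) ^ 2 * (y₂ + (2 / w + 1 / (w - 1)) * y₁
        + (-1 / ((1 + k) * (w - 1) ^ 2) + 1 / ((1 + k) * w * (w - 1))) * y₀) := by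
    field_simp
    ring
  rw [hfactor, hode, mul_zero]
end

section
/- Let a, k ∈ ℂ with a ≠ 0, set g₂ = (k² − 4a)/12, and let x be a twice differentiable function on a domain satisfying x'' = 6x² − g₂/2. Then the function r = (6/a) x + 1 + k/(2a) satisfies r'' = 1 − k(r−1) + a(r−1)². -/
/-- If `x'' = 6x² - g₂/2` with `g₂ = (k² - 4a)/12`, then
`r = (6/a)x + 1 + k/(2a)` satisfies the planar generalised spring-pendulum
equation `r'' = 1 - k(r-1) + a(r-1)²`. -/
theorem weierstrass_gives_particular_solution (a k : ℂ) (ha : a ≠ 0)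
    (g₂ : ℂ) (hg₂ : g₂ = (k ^ 2 - 4 * a) / 12)
    (U : Set ℂ) (hUopen : IsOpen U) (x : ℂ → ℂ)
    (hxdiff : ∀ t ∈ U, DifferentiableAt ℂ x t ∧ DifferentiableAt ℂ (deriv x) t)
    (hx : ∀ t ∈ U, deriv (deriv x) t = 6 * (x t) ^ 2 - g₂ / 2) :
    ∀ t ∈ U,
      deriv (deriv (fun s => 6 / a * x s + 1 + k / (2 * a))) t
        = 1 - k * ((6 / a * x t + 1 + k / (2 * a)) - 1)
          + a * ((6 / a * x t + 1 + k / (2 * a)) - 1) ^ 2 := by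
  intro t ht
  have hderiv : deriv (fun s => 6 / a * x s + 1 + k / (2 * a)) = fun s => 6 / a * deriv x s := by
    funext s
    rw [deriv_add_const, deriv_add_const, deriv_const_mul_field]
  rw [hderiv, deriv_const_mul_field, hx t ht, hg₂]
  field_simp
  ring
end

section
/- Let a, k ∈ ℂ with a ≠ 0. Let r be a twice differentiable nowhere-zero function on a connected open set U satisfying r'' = 1 − k(r−1) + a(r−1)², and define x = (a/6)(r − 1) − k/12 (so that 24x + 2k + 4a = 4ar ≠ 0 on U). If Θ is twice differentiable on U and satisfies the normal variational equation Θ'' + 2(r'/r) Θ' + (1/r) Θ = 0, then the function Φ = Θ · r satisfies Φ'' + ((k² − 144x²)/(24x + 2k + 4a)) Φ = 0 on U. -/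
/-- Along a planar solution `r` of the generalised spring-pendulum, the
substitution `Φ = Θ·r`, with `x = (a/6)(r-1) - k/12`, transforms the normal
variational equation `Θ'' + 2(r'/r)Θ' + (1/r)Θ = 0` into
`Φ'' + ((k² - 144x²)/(24x + 2k + 4a))Φ = 0`. -/
theorem nve_transforms_to_phi_equation (a k : ℂ) (ha : a ≠ 0)
    (U : Set ℂ) (hUopen : IsOpen U) (hUconn : IsConnected U)
    (r Θ : ℂ → ℂ)
    (hrdiff : ∀ t ∈ U, DifferentiableAt ℂ r t ∧ DifferentiableAt ℂ (deriv r) t)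
    (hrne : ∀ t ∈ U, r t ≠ 0)
    (hr : ∀ t ∈ U, deriv (deriv r) t = 1 - k * (r t - 1) + a * (r t - 1) ^ 2)
    (hΘdiff : ∀ t ∈ U, DifferentiableAt ℂ Θ t ∧ DifferentiableAt ℂ (deriv Θ) t)
    (hΘ : ∀ t ∈ U, deriv (deriv Θ) t + 2 * (deriv r t / r t) * deriv Θ t
      + 1 / r t * Θ t = 0) :
    ∀ t ∈ U,
      deriv (deriv (fun s => Θ s * r s)) t
        + (k ^ 2 - 144 * (a / 6 * (r t - 1) - k / 12) ^ 2)
            / (24 * (a / 6 * (r t - 1) - k / 12) + 2 * k + 4 * a)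
          * (Θ t * r t) = 0 := by
  intro t ht
  have hfirst : deriv (fun s => Θ s * r s) =ᶠ[nhds t]
      fun s => deriv Θ s * r s + Θ s * deriv r s := by
    filter_upwards [hUopen.mem_nhds ht] with s hs
    exact ((hΘdiff s hs).1.hasDerivAt.mul (hrdiff s hs).1.hasDerivAt).deriv
  have hr₀ := (hrdiff t ht).1.hasDerivAt
  have hr₁ := (hrdiff t ht).2.hasDerivAt
  have hΘ₀ := (hΘdiff t ht).1.hasDerivAt
  have hΘ₁ := (hΘdiff t ht).2.hasDerivAt
  have hsecond : deriv (deriv (fun s => Θ s * r s)) t =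
      deriv (deriv Θ) t * r t + deriv Θ t * deriv r t
        + (deriv Θ t * deriv r t + Θ t * deriv (deriv r) t) :=
    hfirst.deriv_eq.trans ((hΘ₁.mul hr₀).add (hΘ₀.mul hr₁)).deriv
  have hne := hrne t ht
  have hnve := hΘ t ht
  field_simp at hnve
  have hden : 24 * (a / 6 * (r t - 1) - k / 12) + 2 * k + 4 * a = 4 * a * r t := by ring
  have hcoeff : (k ^ 2 - 144 * (a / 6 * (r t - 1) - k / 12) ^ 2) / (4 * a * r t) * (Θ t * r t) =
      Θ t * ((r t - 1) * (k - a * (r t - 1))) := by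
    field_simp
    ring
  rw [hsecond, hden, hcoeff, hr t ht]
  linear_combination hnve
end

section
/- Let k ∈ ℂ with k ≠ 0 and set a = −k. Let r be a twice differentiable nowhere-zero function on a connected open set U satisfying r'' = 1 − k(r−1) − k(r−1)², and define x = −(k/6)(r − 1) − k/12. If Θ is twice differentiable on U and satisfies Θ'' + 2(r'/r) Θ' + (1/r) Θ = 0, then Φ = Θ · r satisfies the Lamé-type equation Φ'' = (6x + k/2) Φ on U. -/
/-- In the exceptional case `a = -k` of the generalised spring-pendulum, the
substitution `Φ = Θ·r`, with `x = -(k/6)(r-1) - k/12`, transforms the normal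
variational equation `Θ'' + 2(r'/r)Θ' + (1/r)Θ = 0` along a planar solution of
`r'' = 1 - k(r-1) - k(r-1)²` into the Lamé-type equation
`Φ'' = (6x + k/2)Φ`. -/
theorem nve_transforms_to_lame_equation (k : ℂ) (hk : k ≠ 0)
    (U : Set ℂ) (hUopen : IsOpen U) (hUconn : IsConnected U)
    (r Θ : ℂ → ℂ)
    (hrdiff : ∀ t ∈ U, DifferentiableAt ℂ r t ∧ DifferentiableAt ℂ (deriv r) t)
    (hrne : ∀ t ∈ U, r t ≠ 0)
    (hr : ∀ t ∈ U, deriv (deriv r) t = 1 - k * (r t - 1) - k * (r t - 1) ^ 2)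
    (hΘdiff : ∀ t ∈ U, DifferentiableAt ℂ Θ t ∧ DifferentiableAt ℂ (deriv Θ) t)
    (hΘ : ∀ t ∈ U, deriv (deriv Θ) t + 2 * (deriv r t / r t) * deriv Θ t
      + 1 / r t * Θ t = 0) :
    ∀ t ∈ U,
      deriv (deriv (fun s => Θ s * r s)) t
        = (6 * (-(k / 6) * (r t - 1) - k / 12) + k / 2) * (Θ t * r t) := by
  intro t ht
  have hderiv : deriv (fun s => Θ s * r s) =ᶠ[nhds t]
      fun s => deriv Θ s * r s + Θ s * deriv r s := by
    filter_upwards [hUopen.mem_nhds ht] with s hs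
    exact deriv_fun_mul (hΘdiff s hs).1 (hrdiff s hs).1
  obtain ⟨hr₁, hr₂⟩ := hrdiff t ht
  obtain ⟨hΘ₁, hΘ₂⟩ := hΘdiff t ht
  rw [hderiv.deriv_eq, deriv_fun_add (hΘ₂.fun_mul hr₁) (hΘ₁.fun_mul hr₂),
    deriv_fun_mul hΘ₂ hr₁, deriv_fun_mul hΘ₁ hr₂, hr t ht]
  have hrt := hrne t ht
  have hnve := hΘ t ht
  field_simp at hnve
  linear_combination hnve
end
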